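/- Let P be a two-color grid poset with the max property and let L := J_color(P). Suppose L is M-structured for M = [[2,−1],[−1,2]]. Write (a,b) := wt(max). Then a ≥ 0 and b ≥ 0, the polynomial RGF(L,q) is symmetric and unimodal, and RGF(L,q)·(1−q)·(1−q)·(1−q²) = (1−q^{a+1})(1−q^{b+1})(1−q^{a+b+2}) in ℤ[q]. -/

import Mathlib

open scoped Classical

structure GridData (P : Type) [PartialOrder P] where
  m : ℕ
  chain : P → ℕ
  color : P → Fin 2

def IsIdeal {P : Type} [PartialOrder P] (t : Finset P) : Prop :=
  ∀ ⦃x⦄, x ∈ t → ∀ ⦃y⦄, y ≤ x → y ∈ t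

namespace GridData

variable {P : Type} [PartialOrder P] [Fintype P]

/-- The defining properties of a grid poset. -/
def IsGridPoset (G : GridData P) : Prop :=
  1 ≤ G.m ∧
  (∀ u : P, G.chain u ∈ Finset.Icc 1 G.m) ∧
  (∀ i ∈ Finset.Icc 1 G.m, ∃ u : P, G.chain u = i) ∧
  (∀ u v : P, G.chain u = G.chain v → u ≤ v ∨ v ≤ u) ∧
  (∀ u v : P, u ⋖ v → G.chain u = G.chain v ∨ G.chain u = G.chain v + 1)

/-- The defining properties of a two-color grid poset. -/
def IsTwoColorGridPoset (G : GridData P) : Prop :=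
  G.IsGridPoset ∧
  (∀ u v : P, G.chain u = G.chain v → G.color u = G.color v) ∧
  (∀ u v : P, Relation.ReflTransGen (fun x y : P => x ⋖ y ∨ y ⋖ x) u v →
    G.chain u = G.chain v + 1 → G.color u ≠ G.color v)

/-- The max property. -/
def MaxProperty (G : GridData P) : Prop :=
  (∀ u : P, IsMax u → G.chain u ≤ 2) ∧
  (∀ u v : P, IsMax u → IsMax v → u ≠ v → G.color u ≠ G.color v)

/-- The fiber `C i` of the chain function. -/
def fiber (G : GridData P) (i : ℕ) : Finset P :=
  Finset.univ.filter (fun u => G.chain u = i)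

/-- One step in a `γ`-component of `J_color(P)`: add or remove a single vertex of
color `γ` while both sets are order ideals. -/
def GStep (G : GridData P) (γ : Fin 2) (s t : Finset P) : Prop :=
  IsIdeal s ∧ IsIdeal t ∧ ∃ u : P, G.color u = γ ∧
    ((u ∉ s ∧ t = insert u s) ∨ (u ∉ t ∧ s = insert u t))

/-- The `γ`-component of `t` in `J_color(P)`. -/
def comp (G : GridData P) (γ : Fin 2) (t : Finset P) : Set (Finset P) :=
  {s | Relation.ReflTransGen (G.GStep γ) t s}

noncomputable def minCard (G : GridData P) (γ : Fin 2) (t : Finset P) : ℕ :=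
  sInf (Finset.card '' G.comp γ t)

noncomputable def maxCard (G : GridData P) (γ : Fin 2) (t : Finset P) : ℕ :=
  sSup (Finset.card '' G.comp γ t)

/-- `m_γ(t) = 2 ρ_γ(t) - l_γ(t)`. -/
noncomputable def mcoord (G : GridData P) (γ : Fin 2) (t : Finset P) : ℤ :=
  2 * ((t.card : ℤ) - (G.minCard γ t : ℤ)) - ((G.maxCard γ t : ℤ) - (G.minCard γ t : ℤ))

/-- The weight of an element of `J_color(P)` (color `0` is α, color `1` is β). -/
noncomputable def wt (G : GridData P) (t : Finset P) : Fin 2 → ℤ :=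
  ![G.mcoord 0 t, G.mcoord 1 t]

/-- `J_color(P)` is `M`-structured. -/
def MStructured (G : GridData P) (M : Matrix (Fin 2) (Fin 2) ℤ) : Prop :=
  ∀ s t : Finset P, IsIdeal s → IsIdeal t → ∀ u : P, u ∉ s → t = insert u s →
    G.wt s + M (G.color u) = G.wt t

end GridData

open Polynomial in
/-- The rank generating function of the lattice of order ideals of P. -/
noncomputable def RGF (P : Type) [PartialOrder P] [Fintype P] : Polynomial ℤ :=
  ∑ t ∈ Finset.univ.filter (fun t : Finset P => IsIdeal t), X ^ t.card

/-- A polynomial `a_0 + a_1 q + ⋯ + a_l q^l` is symmetric if `a_i = a_{l-i}`. -/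
def PolySymmetric (p : Polynomial ℤ) : Prop :=
  ∀ i ≤ p.natDegree, p.coeff i = p.coeff (p.natDegree - i)

/-- A polynomial is unimodal if its coefficients increase up to some index `k` and
decrease thereafter. -/
def PolyUnimodal (p : Polynomial ℤ) : Prop :=
  ∃ k, (∀ i j, i ≤ j → j ≤ k → p.coeff i ≤ p.coeff j) ∧
    (∀ i j, k ≤ i → i ≤ j → j ≤ p.natDegree → p.coeff j ≤ p.coeff i)

set_option linter.unusedSectionVars false
namespace GridData
variable {P : Type} [PartialOrder P] [Fintype P]

/-- lower end of the component -/
noncomputable def lo (G : GridData P) (γ : Fin 2) (t : Finset P) : Finset P :=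
  Finset.univ.filter (fun y => ∃ w ∈ t, G.color w ≠ γ ∧ y ≤ w)

/-- upper end of the component -/
noncomputable def hi (G : GridData P) (γ : Fin 2) (t : Finset P) : Finset P :=
  Finset.univ.filter (fun v => ∀ w ≤ v, G.color w ≠ γ → w ∈ t)

theorem lo_ideal (G : GridData P) (γ : Fin 2) (t : Finset P) : IsIdeal (G.lo γ t) := by
  intro x hx y hy
  simp only [lo, Finset.mem_filter, Finset.mem_univ, true_and] at hx ⊢
  obtain ⟨w, h1, h2, h3⟩ := hx
  exact ⟨w, h1, h2, hy.trans h3⟩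

theorem hi_ideal (G : GridData P) (γ : Fin 2) (t : Finset P) : IsIdeal (G.hi γ t) := by
  intro x hx y hy
  simp only [hi, Finset.mem_filter, Finset.mem_univ, true_and] at hx ⊢
  exact fun w hw => hx w (hw.trans hy)

theorem lo_sub (G : GridData P) (γ : Fin 2) (t : Finset P) (ht : IsIdeal t) : G.lo γ t ⊆ t := by
  intro x hx
  simp only [lo, Finset.mem_filter, Finset.mem_univ, true_and] at hx
  obtain ⟨w, h1, h2, h3⟩ := hx
  exact ht h1 h3

theorem sub_hi (G : GridData P) (γ : Fin 2) (t : Finset P) (ht : IsIdeal t) : t ⊆ G.hi γ t := by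
  intro x hx
  simp only [hi, Finset.mem_filter, Finset.mem_univ, true_and]
  exact fun w hw _ => ht hx hw

theorem GStep.mem_iff {G : GridData P} {γ : Fin 2} {s t : Finset P} (h : G.GStep γ s t)
    (w : P) (hw : G.color w ≠ γ) : w ∈ s ↔ w ∈ t := by
  obtain ⟨_, _, u, hu, h | h⟩ := h
  · rw [h.2, Finset.mem_insert]
    have : w ≠ u := fun e => hw (e ▸ hu)
    tauto
  · rw [h.2, Finset.mem_insert]
    have : w ≠ u := fun e => hw (e ▸ hu)
    tauto

theorem GStep.symm' {G : GridData P} {γ : Fin 2} {s t : Finset P} (h : G.GStep γ s t) :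
    G.GStep γ t s := by
  obtain ⟨h1, h2, u, hu, h⟩ := h
  exact ⟨h2, h1, u, hu, h.symm⟩

theorem comp_mem_iff {G : GridData P} {γ : Fin 2} {s t : Finset P} (h : s ∈ G.comp γ t)
    (w : P) (hw : G.color w ≠ γ) : w ∈ t ↔ w ∈ s := by
  change Relation.ReflTransGen (G.GStep γ) t s at h
  induction h with
  | refl => rfl
  | tail _ h2 ih => exact ih.trans (h2.mem_iff w hw)

theorem comp_ideal {G : GridData P} {γ : Fin 2} {s t : Finset P} (ht : IsIdeal t)
    (h : s ∈ G.comp γ t) : IsIdeal s := by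
  change Relation.ReflTransGen (G.GStep γ) t s at h
  induction h with
  | refl => exact ht
  | tail _ h2 _ => exact h2.2.1

theorem reach_up (G : GridData P) (γ : Fin 2) (t : Finset P) (ht : IsIdeal t) :
    ∀ (n : ℕ) (s : Finset P), IsIdeal s → s ⊆ t → (∀ w ∈ t, w ∉ s → G.color w = γ) →
      (t \ s).card = n → Relation.ReflTransGen (G.GStep γ) s t := by
  intro n
  induction n with
  | zero =>
    intro s hs hst hc hn
    rw [Finset.card_eq_zero, Finset.sdiff_eq_empty_iff_subset] at hn
    rw [Finset.Subset.antisymm hst hn]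
  | succ n ih =>
    intro s hs hst hc hn
    have hne : (t \ s).Nonempty := by
      rw [← Finset.card_pos]; omega
    obtain ⟨u, hu⟩ := (t \ s).exists_minimal hne
    have hut := (Finset.mem_sdiff.1 hu.1).1
    have hus := (Finset.mem_sdiff.1 hu.1).2
    have hI : IsIdeal (insert u s) := by
      intro x hx y hy
      rw [Finset.mem_insert] at hx ⊢
      rcases hx with rfl | hx
      · by_cases hys : y ∈ s
        · exact Or.inr hys
        · left
          have hyt := ht hut hy
          exact le_antisymm hy (hu.2 (Finset.mem_sdiff.2 ⟨hyt, hys⟩) hy)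
      · exact Or.inr (hs hx hy)
    refine Relation.ReflTransGen.head (b := insert u s)
      ⟨hs, hI, u, hc u hut hus, Or.inl ⟨hus, rfl⟩⟩ (ih _ hI ?_ ?_ ?_)
    · exact Finset.insert_subset hut hst
    · intro w hw hw'
      exact hc w hw (fun h => hw' (Finset.mem_insert_of_mem h))
    · rw [Finset.sdiff_insert, Finset.card_erase_of_mem hu.1, hn]; rfl

theorem hi_mem (G : GridData P) (γ : Fin 2) (t : Finset P) (ht : IsIdeal t) :
    G.hi γ t ∈ G.comp γ t := by
  refine G.reach_up γ _ (G.hi_ideal γ t) _ t ht (G.sub_hi γ t ht) ?_ rfl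
  intro w hw hwt
  by_contra hc
  simp only [hi, Finset.mem_filter, Finset.mem_univ, true_and] at hw
  exact hwt (hw w le_rfl hc)

theorem lo_mem (G : GridData P) (γ : Fin 2) (t : Finset P) (ht : IsIdeal t) :
    G.lo γ t ∈ G.comp γ t := by
  have h := G.reach_up γ t ht _ (G.lo γ t) (G.lo_ideal γ t) (G.lo_sub γ t ht) ?_ rfl
  · have hs : Std.Symm (G.GStep γ) := ⟨fun _ _ h => GStep.symm' h⟩
    exact (Relation.ReflTransGen.stdSymm (r := G.GStep γ)).symm _ _ h
  · intro w hw hwt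
    by_contra hc
    apply hwt
    simp only [lo, Finset.mem_filter, Finset.mem_univ, true_and]
    exact ⟨w, hw, hc, le_rfl⟩

theorem lo_sub_comp {G : GridData P} {γ : Fin 2} {s t : Finset P} (ht : IsIdeal t)
    (h : s ∈ G.comp γ t) : G.lo γ t ⊆ s := by
  intro x hx
  simp only [lo, Finset.mem_filter, Finset.mem_univ, true_and] at hx
  obtain ⟨w, h1, h2, h3⟩ := hx
  exact comp_ideal ht h ((comp_mem_iff h w h2).1 h1) h3

theorem comp_sub_hi {G : GridData P} {γ : Fin 2} {s t : Finset P} (ht : IsIdeal t)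
    (h : s ∈ G.comp γ t) : s ⊆ G.hi γ t := by
  intro x hx
  simp only [hi, Finset.mem_filter, Finset.mem_univ, true_and]
  exact fun w hw hc => (comp_mem_iff h w hc).2 (comp_ideal ht h hx hw)

theorem mcoord_eq (G : GridData P) (γ : Fin 2) (t : Finset P) (ht : IsIdeal t) :
    G.mcoord γ t = 2 * (t.card : ℤ) - (G.lo γ t).card - (G.hi γ t).card := by
  have h1 : G.minCard γ t = (G.lo γ t).card := by
    apply le_antisymm
    · exact Nat.sInf_le ⟨_, G.lo_mem γ t ht, rfl⟩
    · refine le_csInf ⟨_, _, G.lo_mem γ t ht, rfl⟩ ?_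
      rintro _ ⟨s, hs, rfl⟩
      exact Finset.card_le_card (lo_sub_comp ht hs)
  have h2 : G.maxCard γ t = (G.hi γ t).card := by
    have hg : IsGreatest (Finset.card '' G.comp γ t) (G.hi γ t).card := by
      refine ⟨⟨_, G.hi_mem γ t ht, rfl⟩, ?_⟩
      rintro _ ⟨s, hs, rfl⟩
      exact Finset.card_le_card (comp_sub_hi ht hs)
    exact hg.csSup_eq
  rw [mcoord, h1, h2]; ring

theorem wt_eq (G : GridData P) (γ : Fin 2) (t : Finset P) : G.wt t γ = G.mcoord γ t := by
  fin_cases γ <;> rfl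

/-- general version of the down set -/
noncomputable def Dn (G : GridData P) (w : P) : Finset P :=
  Finset.univ.filter (fun x => x < w ∧ G.color x ≠ G.color w ∧
    ∀ w' < w, G.color w' = G.color w → ¬ x ≤ w')

/-- general version of the up set -/
noncomputable def Up (G : GridData P) (w : P) : Finset P :=
  Finset.univ.filter (fun v => w < v ∧ G.color v ≠ G.color w ∧
    ∀ w' ≤ v, G.color w' = G.color w → w' ≤ w)

theorem fin2_ne {a b c : Fin 2} (h : a ≠ b) : c ≠ a ↔ c = b := by
  revert a b c; decide

theorem local_cond (G : GridData P) (hM : G.MStructured !![2, -1; -1, 2]) (w : P) :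
    (G.Dn w).card + (G.Up w).card = 1 := by
  obtain ⟨γ, hγ⟩ : ∃ γ : Fin 2, γ ≠ G.color w := exists_ne _
  have hγ' : ∀ c, c ≠ γ ↔ c = G.color w := fun c => fin2_ne hγ
  set s : Finset P := Finset.univ.filter (fun y => y < w) with hs
  set t : Finset P := Finset.univ.filter (fun y => y ≤ w) with ht
  have hsI : IsIdeal s := by
    intro x hx y hy
    simp only [hs, Finset.mem_filter, Finset.mem_univ, true_and] at hx ⊢
    exact lt_of_le_of_lt hy hx
  have htI : IsIdeal t := by
    intro x hx y hy
    simp only [ht, Finset.mem_filter, Finset.mem_univ, true_and] at hx ⊢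
    exact le_trans hy hx
  have hws : w ∉ s := by simp [hs]
  have hts : t = insert w s := by
    ext y
    simp only [hs, ht, Finset.mem_filter, Finset.mem_univ, true_and, Finset.mem_insert]
    exact le_iff_eq_or_lt
  have h := congrFun (hM s t hsI htI w hws hts) γ
  have hMe : (!![2, -1; -1, 2] : Matrix (Fin 2) (Fin 2) ℤ) (G.color w) γ = -1 := by
    revert hγ
    generalize G.color w = c
    clear hγ' h
    revert c γ; decide
  rw [Pi.add_apply, hMe, wt_eq, wt_eq, G.mcoord_eq γ s hsI, G.mcoord_eq γ t htI] at h
  have hct : t.card = s.card + 1 := by rw [hts, Finset.card_insert_of_notMem hws]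
  have hlo : (G.lo γ t).card = (G.lo γ s).card + ((G.Dn w).card + 1) := by
    have hw' : w ∉ G.Dn w := by simp [Dn]
    rw [← Finset.card_insert_of_notMem hw', ← Finset.card_union_of_disjoint]
    · congr 1
      ext x
      simp only [lo, Dn, hγ', hs, ht, Finset.mem_filter, Finset.mem_univ, true_and,
        Finset.mem_union, Finset.mem_insert]
      constructor
      · rintro ⟨v, h1, h2, h3⟩
        by_cases hx : ∃ w_1 < w, G.color w_1 = G.color w ∧ x ≤ w_1
        · exact Or.inl hx
        · right
          push Not at hx
          have hxw := h3.trans h1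
          rcases hxw.eq_or_lt with h4 | h4
          · exact Or.inl h4
          · right
            exact ⟨h4, fun hc => hx x h4 hc le_rfl, hx⟩
      · rintro (⟨v, h1, h2, h3⟩ | rfl | ⟨h1, h2, h3⟩)
        · exact ⟨v, h1.le, h2, h3⟩
        · exact ⟨x, le_rfl, rfl, le_rfl⟩
        · exact ⟨w, le_rfl, rfl, h1.le⟩
    · rw [Finset.disjoint_left]
      intro x hx hx'
      simp only [lo, Dn, hγ', hs, Finset.mem_filter, Finset.mem_univ, true_and,
        Finset.mem_insert] at hx hx'
      obtain ⟨v, h1, h2, h3⟩ := hx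
      rcases hx' with rfl | ⟨_, _, h4⟩
      · exact absurd h1 (not_lt_of_ge h3)
      · exact h4 v h1 h2 h3
  have hhi : (G.hi γ t).card = (G.hi γ s).card + ((G.Up w).card + 1) := by
    have hw' : w ∉ G.Up w := by simp [Up]
    rw [← Finset.card_insert_of_notMem hw', ← Finset.card_union_of_disjoint]
    · congr 1
      ext x
      simp only [hi, Up, hγ', hs, ht, Finset.mem_filter, Finset.mem_univ, true_and,
        Finset.mem_union, Finset.mem_insert]
      constructor
      · intro h1
        by_cases hx : w ≤ x
        · right
          rcases hx.eq_or_lt with h4 | h4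
          · exact Or.inl h4.symm
          · right
            exact ⟨h4, fun hc => absurd (h1 x le_rfl hc) (not_le_of_gt h4), h1⟩
        · left
          intro v hv hc
          refine lt_of_le_of_ne (h1 v hv hc) ?_
          rintro rfl
          exact hx hv
      · rintro (h1 | rfl | ⟨h1, h2, h3⟩)
        · exact fun v hv hc => (h1 v hv hc).le
        · exact fun v hv _ => hv
        · exact h3
    · rw [Finset.disjoint_left]
      intro x hx hx'
      simp only [hi, Up, hγ', hs, Finset.mem_filter, Finset.mem_univ, true_and,
        Finset.mem_insert] at hx hx'
      rcases hx' with rfl | ⟨h1, _, _⟩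
      · exact lt_irrefl _ (hx x le_rfl rfl)
      · exact lt_irrefl _ (hx w h1.le rfl)
  rw [hct, hlo, hhi] at h
  push_cast at h
  omega

end GridData

namespace GridData
variable {P : Type} [PartialOrder P] [Fintype P]

theorem le_reach {x y : P} (h : x ≤ y) : Relation.ReflTransGen (fun a b : P => a ⋖ b) x y := by
  let : LocallyFiniteOrder P := Fintype.toLocallyFiniteOrder
  exact le_iff_reflTransGen_covBy.1 h

theorem chain_anti {G : GridData P} (hG : G.IsTwoColorGridPoset) {x y : P} (h : x ≤ y) :
    G.chain y ≤ G.chain x := by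
  have h' := le_reach h
  clear h
  induction h' with
  | refl => exact le_rfl
  | @tail b c hab hbc ih =>
    have h1 := hG.1.2.2.2.2 b c hbc
    omega

theorem reach_le {x y : P} (h : Relation.ReflTransGen (fun a b : P => a ⋖ b) x y) : x ≤ y := by
  induction h with
  | refl => exact le_rfl
  | tail _ h2 ih => exact ih.trans h2.le

theorem between {G : GridData P} (hG : G.IsTwoColorGridPoset) {x w : P} (h : x ≤ w) (i : ℕ)
    (h1 : G.chain w ≤ i) (h2 : i ≤ G.chain x) : ∃ y, x ≤ y ∧ y ≤ w ∧ G.chain y = i := by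
  have h' := le_reach h
  clear h
  induction h' with
  | refl => exact ⟨x, le_rfl, le_rfl, by omega⟩
  | @tail b c hab hbc ih =>
    have h3 := hG.1.2.2.2.2 b c hbc
    by_cases hb : G.chain b ≤ i
    · obtain ⟨y, hy1, hy2, hy3⟩ := ih hb
      exact ⟨y, hy1, hy2.trans hbc.le, hy3⟩
    · exact ⟨c, (reach_le hab).trans hbc.le, le_rfl, by omega⟩

theorem color_ne {G : GridData P} (hG : G.IsTwoColorGridPoset) {x w : P} (h : x ≤ w)
    (hc : G.chain x = G.chain w + 1) : G.color x ≠ G.color w :=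
  hG.2.2 x w (Relation.ReflTransGen.mono (fun _ _ h => Or.inl h) _ _ (le_reach h)) hc

theorem mem_Dn {G : GridData P} (hG : G.IsTwoColorGridPoset) (x w : P) :
    x ∈ G.Dn w ↔ G.chain x = G.chain w + 1 ∧ x ≤ w ∧
      ∀ w' < w, G.chain w' = G.chain w → ¬ x ≤ w' := by
  simp only [Dn, Finset.mem_filter, Finset.mem_univ, true_and]
  constructor
  · rintro ⟨h1, h2, h3⟩
    have h4 := chain_anti hG h1.le
    have h5 : G.chain x ≠ G.chain w := fun e => h2 (hG.2.1 _ _ e)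
    refine ⟨?_, h1.le, fun w' hw' hc => h3 w' hw' (hG.2.1 _ _ hc)⟩
    by_contra h6
    obtain ⟨y, hy1, hy2, hy3⟩ := between hG h1.le (G.chain w + 2) (by omega) (by omega)
    obtain ⟨z, hz1, hz2, hz3⟩ := between hG hy2 (G.chain w + 1) (by omega) (by omega)
    have c1 := color_ne hG hz1 (by omega)
    have c2 := color_ne hG hz2 (by omega)
    refine h3 y (lt_of_le_of_ne hy2 ?_) ((fin2_ne c2).1 c1) hy1
    rintro rfl
    omega
  · rintro ⟨h1, h2, h3⟩
    have hne : x ≠ w := by rintro rfl; omega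
    have hc := color_ne hG h2 h1
    refine ⟨lt_of_le_of_ne h2 hne, hc, fun w' hw' hcw hx => ?_⟩
    have h4 := chain_anti hG hw'.le
    have h5 := chain_anti hG hx
    rcases Nat.eq_or_lt_of_le h4 with h6 | h6
    · exact h3 w' hw' h6.symm hx
    · exact hc ((hG.2.1 x w' (by omega)).trans hcw)

theorem mem_Up {G : GridData P} (hG : G.IsTwoColorGridPoset) (v w : P) :
    v ∈ G.Up w ↔ G.chain w = G.chain v + 1 ∧ w ≤ v ∧
      ∀ w' ≤ v, G.chain w' = G.chain w → w' ≤ w := by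
  simp only [Up, Finset.mem_filter, Finset.mem_univ, true_and]
  constructor
  · rintro ⟨h1, h2, h3⟩
    have h4 := chain_anti hG h1.le
    have h5 : G.chain v ≠ G.chain w := fun e => h2 (hG.2.1 _ _ e)
    refine ⟨?_, h1.le, fun w' hw' hc => h3 w' hw' (hG.2.1 _ _ hc)⟩
    by_contra h6
    obtain ⟨y, hy1, hy2, hy3⟩ := between hG h1.le (G.chain w - 2) (by omega) (by omega)
    obtain ⟨z, hz1, hz2, hz3⟩ := between hG hy1 (G.chain w - 1) (by omega) (by omega)
    have c1 := color_ne hG hz1 (by omega)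
    have c2 := color_ne hG hz2 (by omega)
    have h7 := h3 y hy2 ((fin2_ne c2).1 c1).symm
    have h8 := chain_anti hG h7
    omega
  · rintro ⟨h1, h2, h3⟩
    have hne : w ≠ v := by rintro rfl; omega
    have hc := color_ne hG h2 h1
    refine ⟨lt_of_le_of_ne h2 hne, hc.symm, fun w' hw' hcw => ?_⟩
    have h4 := chain_anti hG hw'
    have h5 : G.chain w' ≠ G.chain v := fun e => hc (hcw.symm.trans (hG.2.1 _ _ e))
    obtain ⟨y, hy1, hy2, hy3⟩ := between hG hw' (G.chain w) (by omega) (by omega)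
    exact hy1.trans (h3 y hy2 hy3)

/-- rank inside the fiber -/
noncomputable def rk (G : GridData P) (u : P) : ℕ :=
  (Finset.univ.filter (fun v => G.chain v = G.chain u ∧ v ≤ u)).card

/-- size of a fiber -/
noncomputable def nn (G : GridData P) (i : ℕ) : ℕ :=
  (Finset.univ.filter (fun v => G.chain v = i)).card

theorem rk_pos (G : GridData P) (u : P) : 1 ≤ G.rk u :=
  Finset.card_pos.2 ⟨u, by simp⟩

theorem rk_le (G : GridData P) (u : P) : G.rk u ≤ G.nn (G.chain u) := by
  apply Finset.card_le_card
  intro x hx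
  simp only [Finset.mem_filter, Finset.mem_univ, true_and] at hx ⊢
  exact hx.1

/-- down sets inside a fiber -/
theorem mem_downset {G : GridData P} (hG : G.IsTwoColorGridPoset) (i : ℕ) (S : Finset P)
    (hS : ∀ x ∈ S, G.chain x = i) (hd : ∀ x ∈ S, ∀ y ≤ x, G.chain y = i → y ∈ S)
    (x : P) (hx : G.chain x = i) : x ∈ S ↔ G.rk x ≤ S.card := by
  constructor
  · intro h
    apply Finset.card_le_card
    intro y hy
    simp only [Finset.mem_filter, Finset.mem_univ, true_and] at hy
    exact hd x h y hy.2 (by omega)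
  · intro h
    by_contra hxS
    have : S.card < G.rk x := by
      apply Finset.card_lt_card
      rw [Finset.ssubset_iff_of_subset]
      · exact ⟨x, by simp, hxS⟩
      · intro y hy
        simp only [Finset.mem_filter, Finset.mem_univ, true_and]
        refine ⟨by rw [hS y hy, hx], ?_⟩
        rcases hG.1.2.2.2.1 x y (by rw [hS y hy, hx]) with h1 | h1
        · exact absurd (hd y hy x h1 hx) hxS
        · exact h1
    omega

theorem le_iff_rk {G : GridData P} (hG : G.IsTwoColorGridPoset) (x y : P)
    (h : G.chain x = G.chain y) : x ≤ y ↔ G.rk x ≤ G.rk y := by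
  have := mem_downset hG (G.chain y) (Finset.univ.filter (fun v => G.chain v = G.chain y ∧ v ≤ y))
    (by intro v hv; simp only [Finset.mem_filter, Finset.mem_univ, true_and] at hv; exact hv.1)
    (by
      intro v hv z hz hc
      simp only [Finset.mem_filter, Finset.mem_univ, true_and] at hv ⊢
      exact ⟨hc, hz.trans hv.2⟩) x h
  simp only [Finset.mem_filter, Finset.mem_univ, true_and] at this
  change _ ↔ G.rk x ≤ Finset.card _
  rw [← this]
  tauto

theorem rk_inj {G : GridData P} (hG : G.IsTwoColorGridPoset) (x y : P)
    (h : G.chain x = G.chain y) (hr : G.rk x = G.rk y) : x = y :=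
  le_antisymm ((le_iff_rk hG x y h).2 hr.le) ((le_iff_rk hG y x h.symm).2 hr.ge)

theorem rk_surj {G : GridData P} (hG : G.IsTwoColorGridPoset) (i k : ℕ) (h1 : 1 ≤ k)
    (h2 : k ≤ G.nn i) : ∃ u, G.chain u = i ∧ G.rk u = k := by
  have h3 : ((Finset.univ.filter (fun v => G.chain v = i)).image G.rk) = Finset.Icc 1 (G.nn i) := by
    apply Finset.eq_of_subset_of_card_le
    · intro k hk
      simp only [Finset.mem_image, Finset.mem_filter, Finset.mem_univ, true_and] at hk
      obtain ⟨u, hu, rfl⟩ := hk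
      rw [Finset.mem_Icc]
      exact ⟨G.rk_pos u, hu ▸ G.rk_le u⟩
    · rw [Finset.card_image_of_injOn]
      · simp [nn]
      · intro x hx y hy hxy
        simp only [Finset.coe_filter, Finset.mem_univ, true_and, Set.mem_ofPred_eq] at hx hy
        exact rk_inj hG x y (hx.trans hy.symm) hxy
  have h4 : k ∈ (Finset.univ.filter (fun v => G.chain v = i)).image G.rk := by
    rw [h3, Finset.mem_Icc]; exact ⟨h1, h2⟩
  simp only [Finset.mem_image, Finset.mem_filter, Finset.mem_univ, true_and] at h4
  exact h4

theorem card_rk {G : GridData P} (hG : G.IsTwoColorGridPoset) (i k : ℕ) (h2 : k ≤ G.nn i) :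
    (Finset.univ.filter (fun v => G.chain v = i ∧ G.rk v ≤ k)).card = k := by
  rcases Nat.eq_zero_or_pos k with rfl | h1
  · rw [Finset.card_eq_zero, Finset.filter_eq_empty_iff]
    rintro v _ ⟨_, h⟩
    have := G.rk_pos v
    omega
  · obtain ⟨u, hu, hk⟩ := rk_surj hG i k h1 h2
    conv_rhs => rw [← hk]
    rw [rk]
    congr 1
    ext v
    simp only [Finset.mem_filter, Finset.mem_univ, true_and, hu]
    constructor
    · rintro ⟨h3, h4⟩
      exact ⟨h3, (le_iff_rk hG v u (by omega)).2 (by omega)⟩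
    · rintro ⟨h3, h4⟩
      exact ⟨h3, hk ▸ (le_iff_rk hG v u (by omega)).1 h4⟩

/-- The number of elements in the next fiber below `w` is the sum of the sizes of `Dn`. -/
theorem card_below {G : GridData P} (hG : G.IsTwoColorGridPoset) (w : P) :
    (Finset.univ.filter (fun x => G.chain x = G.chain w + 1 ∧ x ≤ w)).card =
      ∑ w' ∈ Finset.univ.filter (fun v => G.chain v = G.chain w ∧ v ≤ w), (G.Dn w').card := by
  rw [← Finset.card_biUnion]
  · congr 1
    ext x
    simp only [Finset.mem_filter, Finset.mem_univ, true_and, Finset.mem_biUnion, mem_Dn hG]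
    constructor
    · rintro ⟨h1, h2⟩
      obtain ⟨u, hu⟩ := (Finset.univ.filter
        (fun v => G.chain v = G.chain w ∧ v ≤ w ∧ x ≤ v)).exists_minimal ⟨w, by simp [h2]⟩
      have hu1 := hu.1
      simp only [Finset.mem_filter, Finset.mem_univ, true_and] at hu1
      refine ⟨u, ⟨hu1.1, hu1.2.1⟩, by omega, hu1.2.2, ?_⟩
      intro w' hw' hc hx
      have := hu.2 (y := w') (by
        simp only [Finset.mem_filter, Finset.mem_univ, true_and]
        exact ⟨by omega, hw'.le.trans hu1.2.1, hx⟩) hw'.le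
      exact absurd hw' (not_lt_of_ge this)
    · rintro ⟨u, ⟨h1, h2⟩, h3, h4, _⟩
      exact ⟨by omega, h4.trans h2⟩
  · intro u hu v hv huv
    rw [Function.onFun, Finset.disjoint_left]
    intro x hx hx'
    rw [mem_Dn hG] at hx hx'
    simp only [Finset.coe_filter, Finset.mem_univ, true_and, Set.mem_ofPred_eq] at hu hv
    rcases hG.1.2.2.2.1 u v (by omega) with h | h
    · exact hx'.2.2 u (lt_of_le_of_ne h huv) (by omega) hx.2.1
    · exact hx.2.2 v (lt_of_le_of_ne h huv.symm) (by omega) hx'.2.1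

theorem below_iff {G : GridData P} (hG : G.IsTwoColorGridPoset) (w x : P)
    (hx : G.chain x = G.chain w + 1) : x ≤ w ↔ G.rk x ≤
      ∑ w' ∈ Finset.univ.filter (fun v => G.chain v = G.chain w ∧ v ≤ w), (G.Dn w').card := by
  have := mem_downset hG (G.chain w + 1)
    (Finset.univ.filter (fun x => G.chain x = G.chain w + 1 ∧ x ≤ w))
    (by intro v hv; simp only [Finset.mem_filter, Finset.mem_univ, true_and] at hv; exact hv.1)
    (by
      intro v hv z hz hc
      simp only [Finset.mem_filter, Finset.mem_univ, true_and] at hv ⊢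
      exact ⟨hc, hz.trans hv.2⟩) x hx
  rw [card_below hG] at this
  rw [← this]
  simp [hx]

end GridData

section polyfacts
open Polynomial

theorem triple_sum (A B : ℕ) :
    (∑ p ∈ Finset.range (A+1) ×ˢ Finset.range (B+1), ∑ y ∈ Finset.Icc p.2 (B + p.1),
      (X : ℤ[X]) ^ (p.1 + y + p.2)) * ((1 : ℤ[X]) - X) * (1 - X) * (1 - X ^ 2) =
    (1 - X ^ (A+1)) * (1 - X ^ (B+1)) * (1 - X ^ (A+B+2)) := by
  have h1 : (∑ p ∈ Finset.range (A+1) ×ˢ Finset.range (B+1), ∑ y ∈ Finset.Icc p.2 (B + p.1),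
      (X : ℤ[X]) ^ (p.1 + y + p.2)) * ((1 : ℤ[X]) - X) =
      (∑ x ∈ Finset.range (A+1), X ^ x) * (∑ z ∈ Finset.range (B+1), (X^2) ^ z)
      - X ^ (B+1) * ((∑ x ∈ Finset.range (A+1), (X^2) ^ x) * (∑ z ∈ Finset.range (B+1), X ^ z)) := by
    rw [Finset.sum_mul_sum, Finset.sum_mul_sum, ← Finset.sum_product', ← Finset.sum_product',
      Finset.mul_sum, ← Finset.sum_sub_distrib, Finset.sum_mul]
    refine Finset.sum_congr rfl ?_
    rintro ⟨x, z⟩ hp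
    simp only [Finset.mem_product, Finset.mem_range] at hp
    simp only
    have h2 : ∑ y ∈ Finset.Icc z (B + x), (X : ℤ[X]) ^ (x + y + z) =
        X ^ (x + 2 * z) * ∑ i ∈ Finset.range (B + x + 1 - z), X ^ i := by
      rw [← Finset.Ico_add_one_right_eq_Icc, Finset.sum_Ico_eq_sum_range, Finset.mul_sum]
      refine Finset.sum_congr rfl fun i _ => ?_
      rw [← pow_add]; congr 1; ring
    rw [h2, mul_assoc, geom_sum_mul_neg, mul_sub, mul_one, ← pow_add, ← pow_mul, ← pow_mul,
      ← pow_add, ← pow_add, ← pow_add]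
    congr 2
    omega
  have g1 := geom_sum_mul_neg (X : ℤ[X]) (A+1)
  have g2 := geom_sum_mul_neg (X : ℤ[X]) (B+1)
  have g3 := geom_sum_mul_neg ((X : ℤ[X])^2) (A+1)
  have g4 := geom_sum_mul_neg ((X : ℤ[X])^2) (B+1)
  rw [h1]
  generalize ∑ i ∈ Finset.range (A+1), (X : ℤ[X]) ^ i = S1 at *
  generalize ∑ i ∈ Finset.range (B+1), (X : ℤ[X]) ^ i = S2 at *
  generalize ∑ i ∈ Finset.range (A+1), ((X : ℤ[X])^2) ^ i = S3 at *
  generalize ∑ i ∈ Finset.range (B+1), ((X : ℤ[X])^2) ^ i = S4 at *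
  calc _ = (S1 * (1 - X)) * (S4 * (1 - X^2)) - X^(B+1) * ((S3 * (1-X^2)) * (S2 * (1-X))) := by ring
    _ = _ := by rw [g1, g2, g3, g4]; ring

theorem natDegree_one_sub_X_pow (n : ℕ) (hn : n ≠ 0) : (1 - X ^ n : ℤ[X]).natDegree = n := by
  rw [← neg_sub, natDegree_neg]
  simpa using natDegree_X_pow_sub_C (R := ℤ) (n := n) (r := 1)

theorem one_sub_X_pow_ne (n : ℕ) (hn : n ≠ 0) : (1 - X ^ n : ℤ[X]) ≠ 0 := by
  intro h
  have := natDegree_one_sub_X_pow n hn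
  rw [h] at this
  simp at this
  omega

theorem reverse_one_sub_X_pow (n : ℕ) (hn : n ≠ 0) :
    (1 - X ^ n : ℤ[X]).reverse = - (1 - X ^ n) := by
  ext i
  rw [coeff_reverse, natDegree_one_sub_X_pow n hn]
  simp only [coeff_sub, coeff_neg, coeff_one, coeff_X_pow]
  by_cases h : i ≤ n
  · rw [revAt_le h]
    split_ifs <;> omega
  · rw [revAt_eq_self_of_lt (by omega)]
    split_ifs <;> omega

theorem poly_sym_unimodal (p : ℤ[X]) (A B : ℕ)
    (hp : p * ((1 : ℤ[X]) - X) * (1 - X) * (1 - X ^ 2) =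
      (1 - X ^ (A+1)) * (1 - X ^ (B+1)) * (1 - X ^ (A+B+2))) :
    PolySymmetric p ∧ PolyUnimodal p := by
  wlog hBA : B ≤ A generalizing A B
  · refine this B A ?_ (by omega)
    rw [hp, Nat.add_comm B A]; ring
  have e1 : (1 - X : ℤ[X]) = 1 - X ^ 1 := by rw [pow_one]
  have n1 := one_sub_X_pow_ne 1 one_ne_zero
  have n2 := one_sub_X_pow_ne 2 two_ne_zero
  have na := one_sub_X_pow_ne (A+1) (by omega)
  have nb := one_sub_X_pow_ne (B+1) (by omega)
  have nc := one_sub_X_pow_ne (A+B+2) (by omega)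
  have hp0 : p ≠ 0 := by
    rintro rfl
    simp only [zero_mul] at hp
    exact mul_ne_zero (mul_ne_zero na nb) nc hp.symm
  have hp' := hp
  rw [e1] at hp'
  have hdeg : p.natDegree = 2 * (A + B) := by
    have := congrArg natDegree hp'
    rw [natDegree_mul (mul_ne_zero (mul_ne_zero hp0 n1) n1) n2,
      natDegree_mul (mul_ne_zero hp0 n1) n1, natDegree_mul hp0 n1,
      natDegree_mul (mul_ne_zero na nb) nc, natDegree_mul na nb,
      natDegree_one_sub_X_pow _ (by omega), natDegree_one_sub_X_pow _ (by omega),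
      natDegree_one_sub_X_pow _ (by omega), natDegree_one_sub_X_pow _ (by omega),
      natDegree_one_sub_X_pow _ (by omega)] at this
    omega
  have hrev : p.reverse = p := by
    have := congrArg reverse hp'
    simp only [reverse_mul_of_domain] at this
    rw [reverse_one_sub_X_pow _ (by omega), reverse_one_sub_X_pow _ (by omega),
      reverse_one_sub_X_pow _ (by omega), reverse_one_sub_X_pow _ (by omega),
      reverse_one_sub_X_pow _ (by omega)] at this
    have h2 : p.reverse * ((1 - X^1) * (1 - X^1) * (1 - X^2)) =
        p * ((1 - X^1) * (1 - X^1) * (1 - X^2)) := by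
      linear_combination -this - hp'
    exact mul_right_cancel₀ (mul_ne_zero (mul_ne_zero n1 n1) n2) h2
  have hsym : PolySymmetric p := by
    intro i hi
    conv_lhs => rw [← hrev]
    rw [coeff_reverse, revAt_le hi]
  refine ⟨hsym, ?_⟩
  -- increasing up to A+B
  have n1' : (1 - X : ℤ[X]) ≠ 0 := by simpa using n1
  obtain ⟨S, hS⟩ : ∃ S : ℤ[X], S = ∑ i ∈ Finset.range (B+1), X ^ i := ⟨_, rfl⟩
  have hSc : ∀ k, S.coeff k = if k ≤ B then 1 else 0 := by
    intro k
    rw [hS, finsetSum_coeff]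
    simp only [coeff_X_pow]
    rw [Finset.sum_ite_eq]
    simp only [Finset.mem_range, Nat.lt_succ_iff]
  have hq : (p - p * X ^ 1) - (p - p * X ^ 1) * X ^ 2 =
      (S - S * X ^ (A + 1)) - (S - S * X ^ (A + 1)) * X ^ (A+B+2) := by
    have g2 := geom_sum_mul_neg (X : ℤ[X]) (B+1)
    rw [← hS] at g2
    rw [← g2] at hp
    apply mul_right_cancel₀ n1'
    linear_combination hp
  obtain ⟨Q, hQ⟩ : ∃ Q : ℤ[X], Q = p - p * X ^ 1 := ⟨_, rfl⟩
  rw [← hQ] at hq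
  have hrec : ∀ k ≤ A + B, Q.coeff k - (if 2 ≤ k then Q.coeff (k - 2) else 0) =
      (if k ≤ B then 1 else 0) - (if A + 1 ≤ k then 1 else 0) := by
    intro k hk
    have := congrArg (fun r => coeff r k) hq
    simp only [coeff_sub, coeff_mul_X_pow', hSc] at this
    rw [this, if_neg (show ¬ (A + B + 2 ≤ k) by omega)]
    split_ifs <;> omega
  have hclosed : ∀ k : ℕ, k ≤ A + B → Q.coeff k =
      (if k ≤ B then (k : ℤ) / 2 + 1 else ((B : ℤ) - ((k : ℤ) - B) % 2) / 2 + 1)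
      - (if A + 1 ≤ k then ((k : ℤ) - A - 1) / 2 + 1 else 0) := by
    intro k
    induction k using Nat.strong_induction_on with
    | _ k ih =>
      intro hk
      have h1 := hrec k hk
      by_cases h2 : 2 ≤ k
      · have h3 := ih (k - 2) (by omega) (by omega)
        rw [if_pos h2, h3] at h1
        rw [Nat.cast_sub h2] at h1
        split_ifs at h1 ⊢ <;> push_cast at h1 <;> omega
      · rw [if_neg h2] at h1
        split_ifs at h1 ⊢ <;> omega
  have hnn : ∀ k, k + 1 ≤ A + B → p.coeff k ≤ p.coeff (k + 1) := by
    intro k hk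
    have h1 := hclosed (k + 1) hk
    rw [hQ, coeff_sub, coeff_mul_X_pow', if_pos (by omega), Nat.add_sub_cancel] at h1
    split_ifs at h1 <;> push_cast at h1 <;> omega
  have hinc : ∀ i j, i ≤ j → j ≤ A + B → p.coeff i ≤ p.coeff j := by
    intro i j hij
    induction j, hij using Nat.le_induction with
    | base => intro _; exact le_rfl
    | succ j hj ih => intro h; exact (ih (by omega)).trans (hnn j h)
  refine ⟨A + B, hinc, ?_⟩
  intro i j hi hij hj
  rw [hsym i (by omega), hsym j hj]
  exact hinc _ _ (by omega) (by omega)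
end polyfacts

namespace GridData
variable {P : Type} [PartialOrder P] [Fintype P]

/-- The explicit structure forced on `P`. -/
structure Shape (G : GridData P) (A B : ℕ) : Prop where
  n1 : G.nn 1 = B
  n2 : G.nn 2 = A + B
  n3 : G.nn 3 = A
  ch : ∀ u, G.chain u = 1 ∨ G.chain u = 2 ∨ G.chain u = 3
  r21 : ∀ q r, G.chain q = 2 → G.chain r = 1 → (q ≤ r ↔ G.rk q ≤ G.rk r)
  r32 : ∀ p q, G.chain p = 3 → G.chain q = 2 → (p ≤ q ↔ G.rk p + B ≤ G.rk q)
  r31 : ∀ p r, G.chain p = 3 → G.chain r = 1 → ¬ p ≤ r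
  posB : 0 < B

theorem exists_isMax_ge (x : P) : ∃ u, x ≤ u ∧ IsMax u := by
  obtain ⟨u, hu⟩ := (Finset.univ.filter (fun v : P => x ≤ v)).exists_maximal ⟨x, by simp⟩
  have hu1 := hu.1
  simp only [Finset.mem_filter, Finset.mem_univ, true_and] at hu1
  refine ⟨u, hu1, fun v hv => hu.2 ?_ hv⟩
  simp only [Finset.mem_filter, Finset.mem_univ, true_and]
  exact hu1.trans hv

theorem exists_shape {G : GridData P} (hG : G.IsTwoColorGridPoset) (hmax : G.MaxProperty)
    (hM : G.MStructured !![2, -1; -1, 2]) : ∃ A B, G.Shape A B := by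
  have hloc := G.local_cond hM
  have hch : ∀ u, 1 ≤ G.chain u := fun u => (Finset.mem_Icc.1 (hG.1.2.1 u)).1
  -- fiber 1
  have hD1 : ∀ w, G.chain w = 1 → (G.Dn w).card = 1 := by
    intro w hw
    have : G.Up w = ∅ := by
      rw [Finset.eq_empty_iff_forall_notMem]
      intro v hv
      rw [mem_Up hG] at hv
      have := hch v
      omega
    have h := hloc w
    rw [this, Finset.card_empty] at h
    exact h
  have r21 : ∀ q r, G.chain q = 2 → G.chain r = 1 → (q ≤ r ↔ G.rk q ≤ G.rk r) := by
    intro q r hq hr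
    rw [below_iff hG r q (by omega), Finset.sum_congr rfl (g := fun _ => 1)]
    · rw [Finset.sum_const, smul_eq_mul, mul_one]; rfl
    · intro w hw
      simp only [Finset.mem_filter, Finset.mem_univ, true_and] at hw
      exact hD1 w (by omega)
  have hn1pos : 0 < G.nn 1 := by
    obtain ⟨u, hu⟩ := hG.1.2.2.1 1 (Finset.mem_Icc.2 ⟨le_rfl, hG.1.1⟩)
    exact Finset.card_pos.2 ⟨u, by simp [hu]⟩
  have hn12 : G.nn 1 ≤ G.nn 2 := by
    obtain ⟨z, hz1, hz2⟩ := rk_surj hG 1 (G.nn 1) hn1pos le_rfl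
    have h := card_below hG z
    rw [Finset.sum_congr rfl (g := fun _ => 1)] at h
    · rw [Finset.sum_const, smul_eq_mul, mul_one] at h
      change _ = G.rk z at h
      rw [← hz2, ← h]
      apply Finset.card_le_card
      intro x hx
      simp only [Finset.mem_filter, Finset.mem_univ, true_and] at hx ⊢
      omega
    · intro w hw
      simp only [Finset.mem_filter, Finset.mem_univ, true_and] at hw
      exact hD1 w (by omega)
  -- fiber 2
  have hD2 : ∀ q, G.chain q = 2 → (G.Dn q).card = if G.rk q ≤ G.nn 1 then 0 else 1 := by
    intro q hq
    have h := hloc q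
    split_ifs with hr
    · obtain ⟨v, hv1, hv2⟩ := rk_surj hG 1 (G.rk q) (G.rk_pos q) hr
      have : v ∈ G.Up q := by
        rw [mem_Up hG]
        refine ⟨by omega, (r21 q v hq hv1).2 (by omega), fun w' hw' hc => ?_⟩
        rw [le_iff_rk hG _ _ hc, ← hv2]
        exact (r21 w' v (by omega) hv1).1 hw'
      have := Finset.card_pos.2 ⟨v, this⟩
      omega
    · have : G.Up q = ∅ := by
        rw [Finset.eq_empty_iff_forall_notMem]
        intro v hv
        rw [mem_Up hG] at hv
        have hv1 : G.chain v = 1 := by omega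
        have h1 := (r21 q v hq hv1).1 hv.2.1
        have h2 := G.rk_le v
        rw [hv1] at h2
        omega
      rw [this, Finset.card_empty] at h
      exact h
  have sumD2 : ∀ q, G.chain q = 2 →
      ∑ w' ∈ Finset.univ.filter (fun v => G.chain v = G.chain q ∧ v ≤ q), (G.Dn w').card =
        G.rk q - G.nn 1 := by
    intro q hq
    rw [Finset.sum_congr rfl (g := fun w => if G.rk w ≤ G.nn 1 then 0 else 1)]
    · have e : ∀ w, (if G.rk w ≤ G.nn 1 then 0 else 1) = if ¬ (G.rk w ≤ G.nn 1) then 1 else 0 := by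
        intro w; split_ifs <;> rfl
      simp only [e]
      rw [← Finset.card_filter]
      have h1 := Finset.card_filter_add_card_filter_not
        (s := Finset.univ.filter (fun v => G.chain v = G.chain q ∧ v ≤ q))
        (fun w => G.rk w ≤ G.nn 1)
      have h2 : (Finset.univ.filter (fun v => G.chain v = G.chain q ∧ v ≤ q)).card = G.rk q := rfl
      have h3 : ((Finset.univ.filter (fun v => G.chain v = G.chain q ∧ v ≤ q)).filter
        (fun w => G.rk w ≤ G.nn 1)).card = min (G.rk q) (G.nn 1) := by
        rw [← card_rk hG 2 (min (G.rk q) (G.nn 1)) ((min_le_right _ _).trans hn12)]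
        congr 1
        ext v
        simp only [Finset.mem_filter, Finset.mem_univ, true_and, hq, le_min_iff]
        constructor
        · rintro ⟨⟨h3, h4⟩, h5⟩
          exact ⟨h3, (le_iff_rk hG v q (by omega)).1 h4, h5⟩
        · rintro ⟨h3, h4, h5⟩
          exact ⟨⟨h3, (le_iff_rk hG v q (by omega)).2 h4⟩, h5⟩
      omega
    · intro w hw
      simp only [Finset.mem_filter, Finset.mem_univ, true_and] at hw
      exact hD2 w (by omega)
  have r32 : ∀ p q, G.chain p = 3 → G.chain q = 2 → (p ≤ q ↔ G.rk p + G.nn 1 ≤ G.rk q) := by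
    intro p q hp hq
    rw [below_iff hG q p (by omega), sumD2 q hq]
    have := G.rk_pos p
    omega
  have hn3 : G.nn 3 = G.nn 2 - G.nn 1 := by
    apply le_antisymm
    · rcases Nat.eq_zero_or_pos (G.nn 3) with h0 | h0
      · omega
      · obtain ⟨p, hp1, hp2⟩ := rk_surj hG 3 (G.nn 3) h0 le_rfl
        obtain ⟨u, hu1, hu2⟩ := exists_isMax_ge p
        obtain ⟨q, hq1, hq2, hq3⟩ := between hG hu1 2 (hmax.1 u hu2) (by omega)
        have h1 := (r32 p q hp1 hq3).1 hq1
        have h2 := G.rk_le q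
        rw [hq3] at h2
        omega
    · obtain ⟨z, hz1, hz2⟩ := rk_surj hG 2 (G.nn 2) (by omega) le_rfl
      have h := card_below hG z
      rw [sumD2 z hz1, hz2] at h
      rw [← h]
      apply Finset.card_le_card
      intro x hx
      simp only [Finset.mem_filter, Finset.mem_univ, true_and] at hx ⊢
      omega
  -- fiber 3
  have hD3 : ∀ p, G.chain p = 3 → (G.Dn p).card = 0 := by
    intro p hp
    have h := hloc p
    have h1 := G.rk_le p
    rw [hp] at h1
    have h0 := G.rk_pos p
    obtain ⟨q, hq1, hq2⟩ := rk_surj hG 2 (G.rk p + G.nn 1) (by omega) (by omega)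
    have : q ∈ G.Up p := by
      rw [mem_Up hG]
      refine ⟨by omega, (r32 p q hp hq1).2 (by omega), fun w' hw' hc => ?_⟩
      rw [le_iff_rk hG _ _ hc]
      have := (r32 w' q (by omega) hq1).1 hw'
      omega
    have := Finset.card_pos.2 ⟨q, this⟩
    omega
  refine ⟨G.nn 3, G.nn 1, rfl, by omega, rfl, ?_, r21, r32, ?_, hn1pos⟩
  · intro u
    have h1 := hch u
    by_contra h2
    obtain ⟨v, hv1, hv2⟩ := exists_isMax_ge u
    have hv3 := hmax.1 v hv2
    obtain ⟨p, hp1, hp2, hp3⟩ := between hG hv1 3 (by omega) (by omega)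
    obtain ⟨x, hx1, hx2, hx3⟩ := between hG hp1 4 (by omega) (by omega)
    rw [below_iff hG p x (by omega), Finset.sum_congr rfl (g := fun _ => 0)] at hx2
    · have := G.rk_pos x
      simp at hx2
      omega
    · intro w hw
      simp only [Finset.mem_filter, Finset.mem_univ, true_and] at hw
      exact hD3 w (by omega)
  · intro p r hp hr h
    obtain ⟨q, hq1, hq2, hq3⟩ := between hG h 2 (by omega) (by omega)
    have h1 := (r32 p q hp hq3).1 hq1
    have h2 := (r21 q r hq3 hr).1 hq2
    have h3 := G.rk_le r
    have := G.rk_pos p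
    rw [hr] at h3
    omega

/-- part of an ideal in a fiber -/
noncomputable def cnt (G : GridData P) (t : Finset P) (i : ℕ) : ℕ :=
  (t.filter (fun u => G.chain u = i)).card

theorem mem_ideal_iff {G : GridData P} (hG : G.IsTwoColorGridPoset) (t : Finset P)
    (ht : IsIdeal t) (u : P) : u ∈ t ↔ G.rk u ≤ G.cnt t (G.chain u) := by
  have := mem_downset hG (G.chain u) (t.filter (fun v => G.chain v = G.chain u))
    (by intro v hv; exact (Finset.mem_filter.1 hv).2)
    (by
      intro v hv z hz hc
      rw [Finset.mem_filter] at hv ⊢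
      exact ⟨ht hv.1 hz, hc⟩) u rfl
  simpa [cnt] using this

theorem cnt_le (G : GridData P) (t : Finset P) (i : ℕ) : G.cnt t i ≤ G.nn i := by
  apply Finset.card_le_card
  intro x hx
  simp only [Finset.mem_filter, Finset.mem_univ, true_and] at hx ⊢
  exact hx.2

theorem card_cnt {G : GridData P} {A B : ℕ} (hS : G.Shape A B) (t : Finset P) :
    t.card = G.cnt t 3 + G.cnt t 2 + G.cnt t 1 := by
  have h : t.card = ∑ i ∈ ({1, 2, 3} : Finset ℕ), G.cnt t i :=
    Finset.card_eq_sum_card_fiberwise (fun u _ => by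
      rcases hS.ch u with h | h | h <;> simp [h])
  rw [h]
  rw [Finset.sum_insert (by decide), Finset.sum_insert (by decide), Finset.sum_singleton]
  ring

/-- the ideal with given coordinates -/
noncomputable def mkI (G : GridData P) (x y z : ℕ) : Finset P :=
  Finset.univ.filter (fun u =>
    (G.chain u = 1 ∧ G.rk u ≤ z) ∨ (G.chain u = 2 ∧ G.rk u ≤ y) ∨ (G.chain u = 3 ∧ G.rk u ≤ x))

theorem cnt_mk {G : GridData P} (hG : G.IsTwoColorGridPoset) (x y z : ℕ)
    (hx : x ≤ G.nn 3) (hy : y ≤ G.nn 2) (hz : z ≤ G.nn 1) :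
    G.cnt (G.mkI x y z) 1 = z ∧ G.cnt (G.mkI x y z) 2 = y ∧ G.cnt (G.mkI x y z) 3 = x := by
  refine ⟨?_, ?_, ?_⟩
  · conv_rhs => rw [← card_rk hG 1 z hz]
    rw [cnt]; congr 1; ext u
    simp only [mkI, Finset.mem_filter, Finset.mem_univ, true_and]
    omega
  · conv_rhs => rw [← card_rk hG 2 y hy]
    rw [cnt]; congr 1; ext u
    simp only [mkI, Finset.mem_filter, Finset.mem_univ, true_and]
    omega
  · conv_rhs => rw [← card_rk hG 3 x hx]
    rw [cnt]; congr 1; ext u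
    simp only [mkI, Finset.mem_filter, Finset.mem_univ, true_and]
    omega

theorem mk_ideal {G : GridData P} (hG : G.IsTwoColorGridPoset) {A B : ℕ} (hS : G.Shape A B)
    (x y z : ℕ) (h1 : z ≤ y) (h2 : y ≤ B + x) : IsIdeal (G.mkI x y z) := by
  intro u hu v hv
  simp only [mkI, Finset.mem_filter, Finset.mem_univ, true_and] at hu ⊢
  have hc := chain_anti hG hv
  rcases hS.ch u with h3 | h3 | h3 <;> rcases hS.ch v with h4 | h4 | h4
  · have := (le_iff_rk hG v u (by omega)).1 hv
    omega
  · have := (hS.r21 v u h4 h3).1 hv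
    omega
  · exact absurd hv (hS.r31 v u h4 h3)
  · omega
  · have := (le_iff_rk hG v u (by omega)).1 hv
    omega
  · have := (hS.r32 v u h4 h3).1 hv
    omega
  · omega
  · omega
  · have := (le_iff_rk hG v u (by omega)).1 hv
    omega

theorem ideal_cnt {G : GridData P} (hG : G.IsTwoColorGridPoset) {A B : ℕ} (hS : G.Shape A B)
    (t : Finset P) (ht : IsIdeal t) : G.cnt t 1 ≤ G.cnt t 2 ∧ G.cnt t 2 ≤ B + G.cnt t 3 := by
  have c1 := G.cnt_le t 1
  have c2 := G.cnt_le t 2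
  have c3 := G.cnt_le t 3
  have n1 := hS.n1
  have n2 := hS.n2
  have n3 := hS.n3
  constructor
  · rcases Nat.eq_zero_or_pos (G.cnt t 1) with h0 | h0
    · omega
    · obtain ⟨r, hr1, hr2⟩ := rk_surj hG 1 (G.cnt t 1) h0 c1
      obtain ⟨q, hq1, hq2⟩ := rk_surj hG 2 (G.cnt t 1) h0 (by omega)
      have hr : r ∈ t := (mem_ideal_iff hG t ht r).2 (by rw [hr1, hr2])
      have hq := ht hr ((hS.r21 q r hq1 hr1).2 (by omega))
      rw [mem_ideal_iff hG t ht, hq1, hq2] at hq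
      exact hq
  · by_contra h0
    obtain ⟨q, hq1, hq2⟩ := rk_surj hG 2 (G.cnt t 2) (by omega) c2
    obtain ⟨p, hp1, hp2⟩ := rk_surj hG 3 (G.cnt t 2 - B) (by omega) (by omega)
    have hq : q ∈ t := (mem_ideal_iff hG t ht q).2 (by rw [hq1, hq2])
    have hp := ht hq ((hS.r32 p q hp1 hq1).2 (by omega))
    rw [mem_ideal_iff hG t ht, hp1, hp2] at hp
    omega

open Polynomial in
theorem RGF_eq {G : GridData P} (hG : G.IsTwoColorGridPoset) {A B : ℕ} (hS : G.Shape A B) :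
    RGF P = ∑ p ∈ Finset.range (A+1) ×ˢ Finset.range (B+1), ∑ y ∈ Finset.Icc p.2 (B + p.1),
      (X : ℤ[X]) ^ (p.1 + y + p.2) := by
  have n1 := hS.n1
  have n2 := hS.n2
  have n3 := hS.n3
  rw [RGF, Finset.sum_sigma']
  refine Finset.sum_bij' (fun t _ => ⟨(G.cnt t 3, G.cnt t 1), G.cnt t 2⟩)
    (fun c _ => G.mkI c.1.1 c.2 c.1.2) ?_ ?_ ?_ ?_ ?_
  · intro t ht
    have ht := (Finset.mem_filter.1 ht).2
    have h := ideal_cnt hG hS t ht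
    have c1 := G.cnt_le t 1
    have c3 := G.cnt_le t 3
    simp only [Finset.mem_sigma, Finset.mem_product, Finset.mem_range, Finset.mem_Icc]
    omega
  · rintro ⟨⟨x, z⟩, y⟩ h
    simp only [Finset.mem_sigma, Finset.mem_product, Finset.mem_range, Finset.mem_Icc] at h
    simp only [Finset.mem_filter, Finset.mem_univ, true_and]
    exact mk_ideal hG hS x y z h.2.1 h.2.2
  · intro t ht
    have ht := (Finset.mem_filter.1 ht).2
    ext u
    rw [mem_ideal_iff hG t ht]
    simp only [mkI, Finset.mem_filter, Finset.mem_univ, true_and]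
    rcases hS.ch u with h | h | h <;> simp [h]
  · rintro ⟨⟨x, z⟩, y⟩ h
    simp only [Finset.mem_sigma, Finset.mem_product, Finset.mem_range, Finset.mem_Icc] at h
    obtain ⟨h1, h2, h3⟩ := cnt_mk hG x y z (by omega) (by omega) (by omega)
    simp only [h1, h2, h3]
  · intro t _
    rw [card_cnt hS t]

theorem mcoord_univ (G : GridData P) (γ : Fin 2) : G.mcoord γ Finset.univ =
    ((Finset.univ.filter (fun y => ¬ ∃ w, G.color w ≠ γ ∧ y ≤ w)).card : ℤ) := by
  have hI : IsIdeal (Finset.univ : Finset P) := fun _ _ _ _ => Finset.mem_univ _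
  have h1 : G.hi γ Finset.univ = Finset.univ := by simp [hi]
  have h2 : G.lo γ Finset.univ = Finset.univ.filter (fun y => ∃ w, G.color w ≠ γ ∧ y ≤ w) := by
    simp [lo]
  have h3 := Finset.card_filter_add_card_filter_not (s := (Finset.univ : Finset P))
    (fun y => ∃ w, G.color w ≠ γ ∧ y ≤ w)
  rw [G.mcoord_eq γ _ hI, h1, h2]
  omega

theorem weights {G : GridData P} (hG : G.IsTwoColorGridPoset) {A B : ℕ} (hS : G.Shape A B) :
    ∃ c d : Fin 2, c ≠ d ∧ G.mcoord c Finset.univ = B ∧ G.mcoord d Finset.univ = A := by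
  have n1 := hS.n1
  have n2 := hS.n2
  have n3 := hS.n3
  have pB := hS.posB
  obtain ⟨r, hr1, hr2⟩ := rk_surj hG 1 B (by omega) (by omega)
  obtain ⟨q, hq1, hq2⟩ := rk_surj hG 2 B (by omega) (by omega)
  obtain ⟨z, hz1, hz2⟩ := rk_surj hG 2 (A + B) (by omega) (by omega)
  have hcol : G.color q ≠ G.color r := color_ne hG ((hS.r21 q r hq1 hr1).2 (by omega)) (by omega)
  have k1 : ∀ u, G.chain u = 1 → G.color u = G.color r := fun u hu => hG.2.1 _ _ (by omega)
  have k2 : ∀ u, G.chain u = 2 → G.color u = G.color q := fun u hu => hG.2.1 _ _ (by omega)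
  have k3' : ∀ u, G.chain u = 3 → u ≤ z := by
    intro u hu
    have := G.rk_le u
    rw [hu] at this
    exact (hS.r32 u z hu hz1).2 (by omega)
  have k3 : ∀ u, G.chain u = 3 → G.color u = G.color r := by
    intro u hu
    have h := color_ne hG (k3' u hu) (by omega)
    rw [k2 z hz1] at h
    exact (fin2_ne hcol).1 h
  refine ⟨G.color r, G.color q, hcol.symm, ?_, ?_⟩
  · rw [mcoord_univ]
    norm_cast
    rw [← n1, nn]
    congr 1
    ext u
    simp only [Finset.mem_filter, Finset.mem_univ, true_and]
    constructor
    · intro h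
      rcases hS.ch u with h1 | h1 | h1
      · exact h1
      · exact absurd ⟨u, by rw [k2 u h1]; exact hcol, le_rfl⟩ h
      · exact absurd ⟨z, by rw [k2 z hz1]; exact hcol, k3' u h1⟩ h
    · rintro h ⟨w, hw, huw⟩
      have := chain_anti hG huw
      have := hS.ch w
      exact hw (k1 w (by omega))
  · rw [mcoord_univ]
    norm_cast
    have h3 := Finset.card_filter_add_card_filter_not
      (s := Finset.univ.filter (fun u => G.chain u = 2)) (fun u => G.rk u ≤ B)
    rw [Finset.filter_filter, card_rk hG 2 B (by omega), Finset.filter_filter] at h3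
    change B + _ = G.nn 2 at h3
    have h4 : (Finset.univ.filter (fun u => G.chain u = 2 ∧ ¬ G.rk u ≤ B)).card = A := by omega
    rw [← h4]
    congr 1
    ext u
    simp only [Finset.mem_filter, Finset.mem_univ, true_and]
    constructor
    · intro h
      rcases hS.ch u with h1 | h1 | h1
      · exact absurd ⟨u, by rw [k1 u h1]; exact hcol.symm, le_rfl⟩ h
      · refine ⟨h1, fun h2 => h ⟨r, hcol.symm, (hS.r21 u r h1 hr1).2 (by omega)⟩⟩
      · exact absurd ⟨u, by rw [k3 u h1]; exact hcol.symm, le_rfl⟩ h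
    · rintro ⟨h, h'⟩ ⟨w, hw, huw⟩
      have h5 := chain_anti hG huw
      rcases hS.ch w with h6 | h6 | h6
      · have h7 := (hS.r21 u w h h6).1 huw
        have h8 := G.rk_le w
        rw [h6] at h8
        omega
      · exact hw (k2 w h6)
      · omega

end GridData

open Polynomial in
theorem stmt_5 {P : Type} [PartialOrder P] [Fintype P] (G : GridData P)
    (hG : G.IsTwoColorGridPoset) (hmax : G.MaxProperty)
    (hM : G.MStructured !![2, -1; -1, 2])
    (a b : ℤ) (ha : a = G.wt Finset.univ 0) (hb : b = G.wt Finset.univ 1) :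
    0 ≤ a ∧ 0 ≤ b ∧ PolySymmetric (RGF P) ∧ PolyUnimodal (RGF P) ∧
      RGF P * ((1 : ℤ[X]) - X) * (1 - X) * (1 - X ^ 2) = ((1 : ℤ[X]) - X ^ (a + 1).toNat) * (1 - X ^ (b + 1).toNat) * (1 - X ^ (a + b + 2).toNat) := by
  obtain ⟨A, B, hS⟩ := GridData.exists_shape hG hmax hM
  have hR := triple_sum A B
  rw [← GridData.RGF_eq hG hS] at hR
  obtain ⟨h1, h2⟩ := poly_sym_unimodal _ A B hR
  obtain ⟨c, d, hcd, hc, hd⟩ := GridData.weights hG hS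
  rw [GridData.wt_eq] at ha hb
  have hab : (a = A ∧ b = B) ∨ (a = B ∧ b = A) := by
    fin_cases c <;> fin_cases d
    · exact absurd rfl hcd
    · exact Or.inr ⟨ha.trans hc, hb.trans hd⟩
    · exact Or.inl ⟨ha.trans hd, hb.trans hc⟩
    · exact absurd rfl hcd
  rcases hab with ⟨rfl, rfl⟩ | ⟨rfl, rfl⟩
  · refine ⟨by omega, by omega, h1, h2, ?_⟩
    rw [hR, show ((A : ℤ) + 1).toNat = A + 1 by omega, show ((B : ℤ) + 1).toNat = B + 1 by omega,
      show ((A : ℤ) + B + 2).toNat = A + B + 2 by omega]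
  · refine ⟨by omega, by omega, h1, h2, ?_⟩
    rw [hR, show ((A : ℤ) + 1).toNat = A + 1 by omega, show ((B : ℤ) + 1).toNat = B + 1 by omega,
      show ((B : ℤ) + A + 2).toNat = A + B + 2 by omega]
    ring
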